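/- In a deterministic planning problem, define the optimal Q-value function Q* : X × U → ℝ≥0∞ by Q* (x, u) = (ℓ x u : ℝ≥0∞) + G* (f x u), and define the derandomized Q-learning operator on Q : X × U → ℝ≥0∞ at a pair (x, u) by (T_Q Q) (x, u) = (ℓ x u : ℝ≥0∞) + (0 if f x u ∈ G, and ⨅ (u' : U), Q (f x u, u') otherwise). Let Q₀ (x, u) = ⊤ for all (x, u), let z : ℕ → X × U be a schedule in which every state–action pair occurs infinitely often (∀ p, ∀ n, ∃ k ≥ n, z k = p), and define the iterates by Q_{k+1} p = (T_Q Q_k) p if p = z k and Q_{k+1} p = Q_k p otherwise. Then there exists K : ℕ such that for all k ≥ K, Q_k = Q*; that is, derandomized Q-learning (Q-learning with learning rate 1 in a deterministic system) converges exactly to the optimal Q-values after finitely many updates. -/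

import Mathlib

open scoped NNReal ENNReal

variable {X U : Type*}

/-- Trajectory of an action sequence `a` from state `x` under transition function `f`. -/
def traj (f : X → U → X) (x : X) (a : ℕ → U) : ℕ → X
  | 0 => x
  | k + 1 => f (traj f x a k) (a k)

/-- The `K`-stage cost of the action sequence `a` from `x`. -/
def cost (f : X → U → X) (ℓ : X → U → ℝ≥0) (x : X) (a : ℕ → U) (K : ℕ) : ℝ≥0 :=
  ∑ k ∈ Finset.range K, ℓ (traj f x a k) (a k)

/-- The optimal cost-to-go: infimum of cost over all goal-reaching plans (⊤ if none). -/
noncomputable def Gstar (f : X → U → X) (ℓ : X → U → ℝ≥0) (G : Set X) (x : X) : ℝ≥0∞ :=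
  ⨅ (K : ℕ) (a : ℕ → U) (_ : traj f x a K ∈ G), (cost f ℓ x a K : ℝ≥0∞)

/-- The optimal Q-value function. -/
noncomputable def Qstar (f : X → U → X) (ℓ : X → U → ℝ≥0) (G : Set X) :
    X × U → ℝ≥0∞ :=
  fun p => (ℓ p.1 p.2 : ℝ≥0∞) + Gstar f ℓ G (f p.1 p.2)

open Classical in
/-- The derandomized Q-learning operator (Q-learning with learning rate 1). -/
noncomputable def QIter (f : X → U → X) (ℓ : X → U → ℝ≥0) (G : Set X)
    (Q : X × U → ℝ≥0∞) : X × U → ℝ≥0∞ :=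
  fun p => (ℓ p.1 p.2 : ℝ≥0∞) +
    (if f p.1 p.2 ∈ G then 0 else ⨅ (u' : U), Q (f p.1 p.2, u'))

section Plans

variable (f : X → U → X) (ℓ : X → U → ℝ≥0) (G : Set X)

theorem traj_succ_left (x : X) (a : ℕ → U) (k : ℕ) :
    traj f x a (k + 1) = traj f (f x (a 0)) (fun n => a (n + 1)) k := by
  induction k with
  | zero => rfl
  | succ k ih => rw [traj, ih, traj]

theorem cost_succ_left (x : X) (a : ℕ → U) (K : ℕ) :
    cost f ℓ x a (K + 1) =
      ℓ x (a 0) + cost f ℓ (f x (a 0)) (fun n => a (n + 1)) K := by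
  simp only [cost, Finset.sum_range_succ', traj_succ_left]
  exact add_comm _ _

theorem Gstar_le_cost {x : X} {a : ℕ → U} {K : ℕ} (h : traj f x a K ∈ G) :
    Gstar f ℓ G x ≤ cost f ℓ x a K :=
  iInf_le_of_le K (iInf_le_of_le a (iInf_le _ h))

theorem Gstar_eq_zero [Nonempty U] {x : X} (hx : x ∈ G) : Gstar f ℓ G x = 0 := by
  obtain ⟨u⟩ := ‹Nonempty U›
  have h := Gstar_le_cost f ℓ G (x := x) (a := fun _ => u) (K := 0) hx
  simpa [cost] using h

theorem Gstar_le_Qstar (x : X) (u : U) : Gstar f ℓ G x ≤ Qstar f ℓ G (x, u) := by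
  rw [Qstar, Gstar.eq_def f ℓ G (f x u)]
  simp only [ENNReal.add_iInf]
  refine le_iInf fun K => le_iInf fun a => le_iInf fun h => ?_
  have hcons := Gstar_le_cost f ℓ G (x := x) (a := fun n => Nat.casesOn n u a) (K := K + 1)
    (by rw [traj_succ_left]; exact h)
  rw [cost_succ_left] at hcons
  simpa using hcons

theorem QIter_mono : Monotone (QIter f ℓ G) := by
  intro Q Q' h p
  unfold QIter
  gcongr
  split_ifs
  · exact le_rfl
  · exact iInf_mono fun u => h _

theorem Qstar_le_QIter [Nonempty U] : Qstar f ℓ G ≤ QIter f ℓ G (Qstar f ℓ G) := by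
  intro p
  rw [QIter, Qstar]
  gcongr
  split_ifs with h
  · exact (Gstar_eq_zero f ℓ G h).le
  · exact le_iInf fun u => Gstar_le_Qstar f ℓ G _ u

/-- Any Q-function below its own update is below the optimal Q-function. -/
theorem le_Qstar_of_le_QIter {Q : X × U → ℝ≥0∞} (hQ : Q ≤ QIter f ℓ G Q) :
    Q ≤ Qstar f ℓ G := by
  classical
  have key : ∀ (K : ℕ) (y : X) (a : ℕ → U), traj f y a K ∈ G →
      (if y ∈ G then 0 else ⨅ u, Q (y, u)) ≤ (cost f ℓ y a K : ℝ≥0∞) := by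
    intro K
    induction K with
    | zero =>
      intro y a h
      have hy : y ∈ G := h
      simp [hy]
    | succ K ih =>
      intro y a h
      split_ifs with hy
      · exact zero_le
      · rw [traj_succ_left] at h
        rw [cost_succ_left, ENNReal.coe_add]
        refine (iInf_le _ (a 0)).trans ((hQ _).trans ?_)
        rw [QIter]
        gcongr
        convert ih _ _ h
  intro p
  refine (hQ p).trans ?_
  rw [QIter, Qstar]
  gcongr
  refine le_iInf fun K => le_iInf fun a => le_iInf fun h => ?_
  convert key K _ a h

end Plans

/-- The extended nonnegative reals that are `⊤` or a finite sum of stage costs. -/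
def planValues (ℓ : X → U → ℝ≥0) : Set ℝ≥0∞ :=
  insert ⊤ ((↑) '' (AddSubmonoid.closure (Set.range fun p : X × U => ℓ p.1 p.2) : Set ℝ≥0))

theorem planValues_isWF [Finite X] [Finite U] (ℓ : X → U → ℝ≥0) : (planValues ℓ).IsWF := by
  refine Set.IsPWO.isWF (Set.IsPWO.insert (Set.IsPWO.image_of_monotone ?_ ENNReal.coe_mono) _)
  exact Set.IsPWO.addSubmonoid_closure (fun _ _ => zero_le) (Set.finite_range _).isPWO

theorem QIter_mem_planValues [Finite U] [Nonempty U] (f : X → U → X) (ℓ : X → U → ℝ≥0)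
    (G : Set X) {Q : X × U → ℝ≥0∞} (hQ : ∀ p, Q p ∈ planValues ℓ) (p : X × U) :
    QIter f ℓ G Q p ∈ planValues ℓ := by
  have hp : ℓ p.1 p.2 ∈ AddSubmonoid.closure (Set.range fun p : X × U => ℓ p.1 p.2) :=
    AddSubmonoid.subset_closure ⟨p, rfl⟩
  rw [QIter]
  split_ifs
  · exact Or.inr ⟨_, hp, by simp⟩
  · obtain ⟨u, hu⟩ := exists_eq_ciInf_of_finite (f := fun u => Q (f p.1 p.2, u))
    rw [← hu]
    rcases hQ (f p.1 p.2, u) with h | ⟨c, hc, h⟩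
    · exact Or.inl (by simp [h])
    · exact Or.inr ⟨_, add_mem hp hc, by simp [← h]⟩

theorem Antitone.eventually_const_of_mem_isWF {α : Type*} [LinearOrder α] {s : Set α}
    (hs : s.IsWF) {v : ℕ → α} (hv : Antitone v) (hmem : ∀ k, v k ∈ s) :
    ∃ c, ∀ᶠ k in Filter.atTop, v k = c := by
  have hr : (Set.range v).IsWF := hs.mono (Set.range_subset_iff.2 hmem)
  obtain ⟨K, hK⟩ := hr.min_mem (Set.range_nonempty v)
  refine ⟨v K, Filter.eventually_atTop.2 ⟨K, fun k hk => (hv hk).antisymm ?_⟩⟩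
  rw [hK]
  exact hr.min_le _ ⟨k, rfl⟩

open Classical in
/-- Proposition 1: derandomized Q-learning, updating every state–action pair
infinitely often, converges exactly to the optimal Q-values after finitely many
updates. -/
theorem derandomized_Q_learning_converges [Fintype X] [Fintype U] [Nonempty U]
    (f : X → U → X) (ℓ : X → U → ℝ≥0) (G : Set X)
    (z : ℕ → X × U) (hz : ∀ p : X × U, ∀ n : ℕ, ∃ k ≥ n, z k = p)
    (Q : ℕ → X × U → ℝ≥0∞)
    (hQ0 : Q 0 = fun _ => ⊤)
    (hstep : ∀ k : ℕ, ∀ p : X × U,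
      Q (k + 1) p = if p = z k then QIter f ℓ G (Q k) p else Q k p) :
    ∃ K : ℕ, ∀ k ≥ K, Q k = Qstar f ℓ G := by
  have hpre : ∀ k, QIter f ℓ G (Q k) ≤ Q k ∧ Q (k + 1) ≤ Q k := by
    have hdec : ∀ k, QIter f ℓ G (Q k) ≤ Q k → Q (k + 1) ≤ Q k := by
      intro k h p
      rw [hstep]
      split_ifs
      · exact h p
      · exact le_rfl
    intro k
    induction k with
    | zero =>
      have h : QIter f ℓ G (Q 0) ≤ Q 0 := fun p => by simp [hQ0]
      exact ⟨h, hdec 0 h⟩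
    | succ k ih =>
      have h : QIter f ℓ G (Q (k + 1)) ≤ Q (k + 1) := by
        intro p
        have hp := QIter_mono f ℓ G ih.2 p
        rw [hstep k p]
        split_ifs
        · exact hp
        · exact hp.trans (ih.1 p)
      exact ⟨h, hdec _ h⟩
  have hanti : Antitone Q := antitone_nat_of_succ_le fun k => (hpre k).2
  have hmem : ∀ k p, Q k p ∈ planValues ℓ := by
    intro k
    induction k with
    | zero => exact fun p => Or.inl (by simp [hQ0])
    | succ k ih =>
      intro p
      rw [hstep]
      split_ifs
      · exact QIter_mem_planValues f ℓ G ih p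
      · exact ih p
  have hlower : ∀ k, Qstar f ℓ G ≤ Q k := by
    intro k
    induction k with
    | zero => exact fun p => by simp [hQ0]
    | succ k ih =>
      intro p
      rw [hstep]
      split_ifs
      · exact (Qstar_le_QIter f ℓ G p).trans (QIter_mono f ℓ G ih p)
      · exact ih p
  have hconst : ∀ p, ∃ c, ∀ᶠ k in Filter.atTop, Q k p = c := fun p =>
    Antitone.eventually_const_of_mem_isWF (planValues_isWF ℓ)
      (fun _ _ h => hanti h p) (fun k => hmem k p)
  choose Qlim hQlim using hconst
  obtain ⟨K, hK⟩ := Filter.eventually_atTop.1 (Filter.eventually_all.2 hQlim)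
  have hlim : ∀ k ≥ K, Q k = Qlim := fun k hk => funext (hK k hk)
  have hfix : Qlim ≤ QIter f ℓ G Qlim := by
    intro p
    obtain ⟨k, hk, rfl⟩ := hz p K
    have h := hstep k (z k)
    rw [if_pos rfl, hlim k hk, hlim (k + 1) (Nat.le_succ_of_le hk)] at h
    exact h.le
  refine ⟨K, fun k hk => le_antisymm ?_ (hlower k)⟩
  rw [hlim k hk]
  exact le_Qstar_of_le_QIter f ℓ G hfix
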